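/- arXiv:2102.07081 — 9 statements merged into one kernel-verified Lean document; each statement's English description precedes it below -/
import Mathlib

section
/- Let n ≥ 1, let 𝒟 be a nonempty convex subset of the standard simplex Δⁿ, and let s : 𝒟 → ℝⁿ be a strictly proper scoring rule, i.e. for all p, x ∈ 𝒟 with x ≠ p one has ⟨p, s(p)⟩ > ⟨p, s(x)⟩. Then the expected reward function G(p) := ⟨p, s(p)⟩ is strictly convex on 𝒟. -/
open scoped InnerProductSpace BigOperators

/-- the expected reward function `G(p) = ⟨p, s(p)⟩` of a strictly proper
scoring rule is strictly convex on the forecast domain. -/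
theorem stmt_1 {n : ℕ} (hn : 1 ≤ n) (D : Set (EuclideanSpace ℝ (Fin n)))
    (hne : D.Nonempty) (hconv : Convex ℝ D)
    (hsub : D ⊆ {p : EuclideanSpace ℝ (Fin n) | (∀ j, 0 ≤ p j) ∧ ∑ j, p j = 1})
    (s : EuclideanSpace ℝ (Fin n) → EuclideanSpace ℝ (Fin n))
    (hproper : ∀ p ∈ D, ∀ x ∈ D, x ≠ p → ⟪p, s x⟫_ℝ < ⟪p, s p⟫_ℝ) :
    StrictConvexOn ℝ D (fun p => ⟪p, s p⟫_ℝ) := by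
  refine ⟨hconv, fun x hx y hy hxy a b ha hb hab => ?_⟩
  have hz : a • x + b • y ∈ D := hconv hx hy ha.le hb.le hab
  have hzx : a • x + b • y ≠ x := by
    intro h
    have : b • (y - x) = 0 := by
      rw [smul_sub, sub_eq_zero]
      calc b • y = (a • x + b • y) - a • x := by abel
        _ = (a + b) • x - a • x := by rw [h, hab, one_smul]
        _ = b • x := by rw [add_smul, add_sub_cancel_left]
    rcases smul_eq_zero.mp this with h0 | h0
    · exact hb.ne' h0
    · exact hxy (sub_eq_zero.mp h0).symm
  have hzy : a • x + b • y ≠ y := by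
    intro h
    have : a • (x - y) = 0 := by
      rw [smul_sub, sub_eq_zero]
      calc a • x = (a • x + b • y) - b • y := by abel
        _ = (a + b) • y - b • y := by rw [h, hab, one_smul]
        _ = a • y := by rw [add_smul, add_sub_cancel_right]
    rcases smul_eq_zero.mp this with h0 | h0
    · exact ha.ne' h0
    · exact hxy (sub_eq_zero.mp h0)
  have h₁ := mul_lt_mul_of_pos_left (hproper x hx _ hz hzx) ha
  have h₂ := mul_lt_mul_of_pos_left (hproper y hy _ hz hzy) hb
  simpa only [inner_add_left, real_inner_smul_left, smul_eq_mul] using add_lt_add h₁ h₂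
end

section
/- Let 𝒟 ⊆ [0,1] be an interval containing more than one point and let g : 𝒟 → ℝ be continuous and strictly increasing. Then the QA pooling operator ⊕_g on weighted forecasts, defined by (p₁,w₁) ⊕_g (p₂,w₂) := (g⁻¹((w₁g(p₁)+w₂g(p₂))/(w₁+w₂)), w₁+w₂), satisfies all six pooling axioms: weight additivity, commutativity, associativity, continuity, idempotence, and monotonicity. -/
/-- The QA pooling operator `⊕_g` on weighted forecasts:
`(p₁,w₁) ⊕_g (p₂,w₂) = (g⁻¹((w₁g(p₁)+w₂g(p₂))/(w₁+w₂)), w₁+w₂)`, where `g⁻¹` is the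
inverse of `g` on `D` (realized by `Function.invFunOn`). -/
noncomputable def qaPool (g : ℝ → ℝ) (D : Set ℝ) (a b : ℝ × ℝ) : ℝ × ℝ :=
  (Function.invFunOn g D ((a.2 * g a.1 + b.2 * g b.1) / (a.2 + b.2)), a.2 + b.2)

/-- The six axioms for a pooling operator `op` on weighted forecasts `𝒟 × ℝ_{>0}`:
closure, weight additivity, commutativity, associativity, continuity (in the weights,
with the natural boundary values), idempotence, and monotonicity. -/
structure PoolingAxioms (D : Set ℝ) (op : ℝ × ℝ → ℝ × ℝ → ℝ × ℝ) : Prop where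
  mem : ∀ p₁ ∈ D, ∀ p₂ ∈ D, ∀ w₁ > (0:ℝ), ∀ w₂ > (0:ℝ),
    (op (p₁, w₁) (p₂, w₂)).1 ∈ D
  weight_add : ∀ p₁ ∈ D, ∀ p₂ ∈ D, ∀ w₁ > (0:ℝ), ∀ w₂ > (0:ℝ),
    (op (p₁, w₁) (p₂, w₂)).2 = w₁ + w₂
  comm : ∀ p₁ ∈ D, ∀ p₂ ∈ D, ∀ w₁ > (0:ℝ), ∀ w₂ > (0:ℝ),
    op (p₁, w₁) (p₂, w₂) = op (p₂, w₂) (p₁, w₁)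
  assoc : ∀ p₁ ∈ D, ∀ p₂ ∈ D, ∀ p₃ ∈ D, ∀ w₁ > (0:ℝ), ∀ w₂ > (0:ℝ), ∀ w₃ > (0:ℝ),
    op (p₁, w₁) (op (p₂, w₂) (p₃, w₃)) = op (op (p₁, w₁) (p₂, w₂)) (p₃, w₃)
  continuity : ∀ p₁ ∈ D, ∀ p₂ ∈ D, ∃ f : ℝ × ℝ → ℝ,
    ContinuousOn f {x : ℝ × ℝ | 0 ≤ x.1 ∧ 0 ≤ x.2 ∧ x ≠ (0, 0)} ∧
    (∀ w₁ > (0:ℝ), ∀ w₂ > (0:ℝ), f (w₁, w₂) = (op (p₁, w₁) (p₂, w₂)).1) ∧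
    (∀ w₁ > (0:ℝ), f (w₁, 0) = p₁) ∧ (∀ w₂ > (0:ℝ), f (0, w₂) = p₂)
  idem : ∀ p ∈ D, ∀ w₁ > (0:ℝ), ∀ w₂ > (0:ℝ), (op (p, w₁) (p, w₂)).1 = p
  mono : ∀ w > (0:ℝ), ∀ p₁ ∈ D, ∀ p₂ ∈ D, p₂ < p₁ →
    StrictMonoOn (fun x => (op (p₁, x) (p₂, w - x)).1) (Set.Ioo 0 w)

/-- A strictly monotone map on an order-connected set with order-connected image has a
continuous inverse. -/
theorem StrictMonoOn.continuousOn_invFunOn {D : Set ℝ} {g : ℝ → ℝ} (hD : D.OrdConnected)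
    (hI : (g '' D).OrdConnected) (hmono : StrictMonoOn g D) :
    ContinuousOn (Function.invFunOn g D) (g '' D) := by
  rw [continuousOn_iff_continuous_domRestrict]
  have hc : Continuous fun y : g '' D => ((hmono.orderIso g D).symm y : ℝ) :=
    continuous_subtype_val.comp (OrderIso.continuous _)
  convert hc using 1
  funext y
  obtain ⟨x, rfl⟩ := (hmono.orderIso g D).surjective y
  rw [OrderIso.symm_apply_apply]
  exact hmono.injOn.leftInvOn_invFunOn x.2

/-- A weighted average of two elements of a convex set of reals lies in the set. -/
theorem Convex.weighted_avg_mem {I : Set ℝ} (hI : Convex ℝ I) {a b u v : ℝ} (ha : a ∈ I)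
    (hb : b ∈ I) (hu : 0 ≤ u) (hv : 0 ≤ v) (huv : 0 < u + v) :
    (u * a + v * b) / (u + v) ∈ I := by
  have h := hI ha hb (div_nonneg hu huv.le) (div_nonneg hv huv.le)
    (by rw [← add_div, div_self huv.ne'])
  convert h using 1
  simp only [smul_eq_mul]
  ring

/-- for any continuous, strictly increasing `g` on a two-outcome forecast
domain `𝒟 ⊆ [0,1]` (an interval with more than one point), the QA pooling operator
`⊕_g` satisfies all six pooling axioms. -/
theorem stmt_10 (D : Set ℝ) (hDsub : D ⊆ Set.Icc 0 1) (hDconv : Convex ℝ D)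
    (hne : ∃ a ∈ D, ∃ b ∈ D, a ≠ b)
    (g : ℝ → ℝ) (hg : ContinuousOn g D) (hmono : StrictMonoOn g D) :
    PoolingAxioms D (qaPool g D) := by
  have hI : (g '' D).OrdConnected := (hDconv.isPreconnected.image g hg).ordConnected
  have avg_mem {p q u v : ℝ} (hp : p ∈ D) (hq : q ∈ D) (hu : 0 ≤ u) (hv : 0 ≤ v)
      (huv : 0 < u + v) : (u * g p + v * g q) / (u + v) ∈ g '' D :=
    hI.convex.weighted_avg_mem (Set.mem_image_of_mem g hp) (Set.mem_image_of_mem g hq) hu hv huv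
  have left_inv {p : ℝ} (hp : p ∈ D) : Function.invFunOn g D (g p) = p :=
    hmono.injOn.leftInvOn_invFunOn hp
  have pool_mem {p q u v : ℝ} (hp : p ∈ D) (hq : q ∈ D) (hu : 0 < u) (hv : 0 < v) :
      (qaPool g D (p, u) (q, v)).1 ∈ D :=
    Function.invFunOn_mem (avg_mem hp hq hu.le hv.le (add_pos hu hv))
  have g_pool {p q u v : ℝ} (hp : p ∈ D) (hq : q ∈ D) (hu : 0 < u) (hv : 0 < v) :
      g (Function.invFunOn g D ((u * g p + v * g q) / (u + v))) =
        (u * g p + v * g q) / (u + v) :=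
    Function.invFunOn_eq (avg_mem hp hq hu.le hv.le (add_pos hu hv))
  refine ⟨fun p hp q hq u hu v hv => pool_mem hp hq hu hv, fun _ _ _ _ _ _ _ _ => rfl,
    fun p _ q _ u _ v _ => ?_, fun p hp q hq r hr u hu v hv w hw => ?_,
    fun p hp q hq => ⟨fun x => Function.invFunOn g D ((x.1 * g p + x.2 * g q) / (x.1 + x.2)),
      ?_, fun _ _ _ _ => rfl, fun u hu => ?_, fun v hv => ?_⟩,
    fun p hp u hu v hv => ?_, fun w hw p hp q hq hqp x hx y hy hxy => ?_⟩
  · simp only [qaPool, add_comm]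
  · have huv : u + v ≠ 0 := (add_pos hu hv).ne'
    have hvw : v + w ≠ 0 := (add_pos hv hw).ne'
    simp only [qaPool, g_pool hq hr hv hw, g_pool hp hq hu hv]
    rw [mul_div_cancel₀ _ hvw, mul_div_cancel₀ _ huv]
    simp only [add_assoc]
  · have pos {x : ℝ × ℝ} (hx : 0 ≤ x.1 ∧ 0 ≤ x.2 ∧ x ≠ (0, 0)) : 0 < x.1 + x.2 := by
      obtain ⟨h₁, h₂, h₃⟩ := hx
      refine lt_of_le_of_ne (add_nonneg h₁ h₂) fun h => h₃ (Prod.ext ?_ ?_) <;>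
        simp only <;> linarith
    refine (hmono.continuousOn_invFunOn hDconv.ordConnected hI).comp ?_
      fun x hx => avg_mem hp hq hx.1 hx.2.1 (pos hx)
    exact ContinuousOn.div (by fun_prop) (by fun_prop) fun x hx => (pos hx).ne'
  · have hu' : u ≠ 0 := ne_of_gt hu
    simp [hu', left_inv hp]
  · have hv' : v ≠ 0 := ne_of_gt hv
    simp [hv', left_inv hq]
  · simp only [qaPool]
    rw [← add_mul, mul_div_cancel_left₀ _ (add_pos hu hv).ne', left_inv hp]
  · have hx' : 0 < w - x := sub_pos.2 hx.2
    have hy' : 0 < w - y := sub_pos.2 hy.2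
    refine (hmono.lt_iff_lt (pool_mem hp hq hx.1 hx') (pool_mem hp hq hy.1 hy')).1 ?_
    simp only [qaPool]
    rw [g_pool hp hq hx.1 hx', g_pool hp hq hy.1 hy', add_sub_cancel, add_sub_cancel]
    have hlt : g q < g p := hmono hq hp hqp
    gcongr ?_ / w
    nlinarith [mul_pos (sub_pos.2 hxy) (sub_pos.2 hlt)]
end

section
/- Let 𝒟 ⊆ [0,1] be an interval containing more than one point and let ⊕ be a pooling operator on 𝒟 × ℝ_{>0} satisfying the six axioms: weight additivity, commutativity, associativity, continuity, idempotence, and monotonicity. Then there exists a continuous, strictly increasing function g : 𝒟 → ℝ such that ⊕ = ⊕_g, i.e., for all (p₁,w₁), (p₂,w₂) ∈ 𝒟 × ℝ_{>0}, (p₁,w₁) ⊕ (p₂,w₂) = (g⁻¹((w₁g(p₁)+w₂g(p₂))/(w₁+w₂)), w₁+w₂). -/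
open Set Topology

theorem StrictMonoOn.Icc_of_Ioo {a b : ℝ} {f : ℝ → ℝ} (hf : StrictMonoOn f (Ioo a b))
    (hc : ContinuousOn f (Icc a b)) : StrictMonoOn f (Icc a b) := by
  intro s hs t ht hst
  obtain ⟨x, hsx, hxt⟩ := exists_between hst
  obtain ⟨y, hxy, hyt⟩ := exists_between hxt
  have hx : x ∈ Ioo a b := ⟨hs.1.trans_lt hsx, hxt.trans_le ht.2⟩
  have hy : y ∈ Ioo a b := ⟨hx.1.trans hxy, hyt.trans_le ht.2⟩
  have h₁ : f s ≤ f x := by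
    refine ContinuousWithinAt.closure_le (s := Ioo s x) (f := f) (g := fun _ => f x) ?_ ?_
      continuousWithinAt_const ?_
    · rw [closure_Ioo hsx.ne]; exact left_mem_Icc.2 hsx.le
    · exact (hc s hs).mono fun u hu => ⟨hs.1.trans hu.1.le, hu.2.le.trans hx.2.le⟩
    · exact fun u hu => (hf ⟨hs.1.trans_lt hu.1, hu.2.trans hx.2⟩ hx hu.2).le
  have h₂ : f y ≤ f t := by
    refine ContinuousWithinAt.closure_le (s := Ioo y t) (g := f) (f := fun _ => f y) ?_
      continuousWithinAt_const ?_ ?_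
    · rw [closure_Ioo hyt.ne]; exact right_mem_Icc.2 hyt.le
    · exact (hc t ht).mono fun u hu => ⟨hy.1.le.trans hu.1.le, hu.2.le.trans ht.2⟩
    · exact fun u hu => (hf hy ⟨hy.1.trans hu.1, hu.2.trans_le ht.2⟩ hu.1).le
  exact h₁.trans_lt ((hf hx hy hxy).trans_le h₂)

/-- `h` turns pooling of forecasts from `s` into the weighted arithmetic mean. -/
def IsQuasiMean (op : ℝ × ℝ → ℝ × ℝ → ℝ × ℝ) (s : Set ℝ) (h : ℝ → ℝ) : Prop :=
  ∀ p₁ ∈ s, ∀ p₂ ∈ s, ∀ w₁ > (0 : ℝ), ∀ w₂ > (0 : ℝ),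
    h (op (p₁, w₁) (p₂, w₂)).1 = (w₁ * h p₁ + w₂ * h p₂) / (w₁ + w₂)

namespace PoolingAxioms

variable {D : Set ℝ} {op : ℝ × ℝ → ℝ × ℝ → ℝ × ℝ}

/-- The pool of two forecasts, extended to boundary weights, is additive in the weights. -/
theorem op_extend_add (hax : PoolingAxioms D op) {c d : ℝ} (hc : c ∈ D) (hd : d ∈ D)
    {f : ℝ × ℝ → ℝ}
    (hf : ∀ w₁ > (0 : ℝ), ∀ w₂ > (0 : ℝ), f (w₁, w₂) = (op (d, w₁) (c, w₂)).1)
    (hf₁ : ∀ w₁ > (0 : ℝ), f (w₁, 0) = d) (hf₂ : ∀ w₂ > (0 : ℝ), f (0, w₂) = c)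
    {x y x' y' : ℝ} (hx : 0 ≤ x) (hy : 0 ≤ y) (hxy : 0 < x + y)
    (hx' : 0 ≤ x') (hy' : 0 ≤ y') (hxy' : 0 < x' + y') :
    op (f (x, y), x + y) (f (x', y'), x' + y') =
      (f (x + x', y + y'), (x + x') + (y + y')) := by
  have pos : ∀ w₁ > (0 : ℝ), ∀ w₂ > (0 : ℝ), op (d, w₁) (c, w₂) = (f (w₁, w₂), w₁ + w₂) :=
    fun w₁ h₁ w₂ h₂ => Prod.ext (hf w₁ h₁ w₂ h₂).symm (hax.weight_add d hd c hc w₁ h₁ w₂ h₂)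
  have idem : ∀ p ∈ D, ∀ w₁ > (0 : ℝ), ∀ w₂ > (0 : ℝ), op (p, w₁) (p, w₂) = (p, w₁ + w₂) :=
    fun p hp w₁ h₁ w₂ h₂ => Prod.ext (hax.idem p hp w₁ h₁ w₂ h₂)
      (hax.weight_add p hp p hp w₁ h₁ w₂ h₂)
  have left : ∀ a > (0 : ℝ), ∀ x ≥ (0 : ℝ), ∀ y ≥ (0 : ℝ), 0 < x + y →
      op (d, a) (f (x, y), x + y) = (f (a + x, y), a + x + y) := by
    intro a ha x hx y hy hxy
    rcases hx.eq_or_lt with rfl | hx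
    · have hy : 0 < y := by linarith
      rw [hf₂ y hy, zero_add, pos a ha y hy, add_zero]
    rcases hy.eq_or_lt with rfl | hy
    · rw [hf₁ x hx, hf₁ (a + x) (by linarith), add_zero, add_zero, idem d hd a ha x hx]
    · rw [← pos x hx y hy, hax.assoc d hd d hd c hc a ha x hx y hy, idem d hd a ha x hx,
        pos (a + x) (by linarith) y hy]
  have right : ∀ b > (0 : ℝ), ∀ x ≥ (0 : ℝ), ∀ y ≥ (0 : ℝ), 0 < x + y →
      op (c, b) (f (x, y), x + y) = (f (x, b + y), x + (b + y)) := by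
    intro b hb x hx y hy hxy
    rcases hx.eq_or_lt with rfl | hx
    · have hy : 0 < y := by linarith
      rw [hf₂ y hy, hf₂ (b + y) (by linarith), zero_add, zero_add, idem c hc b hb y hy]
    rcases hy.eq_or_lt with rfl | hy
    · rw [hf₁ x hx, add_zero, add_zero, hax.comm c hc d hd b hb x hx, pos x hx b hb]
    · rw [← pos x hx y hy, hax.comm d hd c hc x hx y hy,
        hax.assoc c hc c hc d hd b hb y hy x hx, idem c hc b hb y hy,
        hax.comm c hc d hd _ (by linarith) x hx, pos x hx (b + y) (by linarith)]
  rcases hx.eq_or_lt with rfl | hx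
  · have hy : 0 < y := by linarith
    rw [hf₂ y hy, zero_add, zero_add, right y hy x' hx' y' hy' hxy']
  rcases hy.eq_or_lt with rfl | hy
  · rw [hf₁ x hx, add_zero, zero_add, left x hx x' hx' y' hy' hxy', add_assoc]
  · have hmem : f (x', y') ∈ D := by
      rcases hx'.eq_or_lt with rfl | hx'
      · rwa [hf₂ y' (by linarith)]
      rcases hy'.eq_or_lt with rfl | hy'
      · rwa [hf₁ x' hx']
      · rw [hf x' hx' y' hy']; exact hax.mem d hd c hc x' hx' y' hy'
    rw [← pos x hx y hy, ← hax.assoc d hd c hc _ hmem x hx y hy _ hxy',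
      right y hy x' hx' y' hy' hxy', left x hx x' hx' (y + y') (by linarith) (by linarith)]

/-- Pools of two forecasts depend only on the ratio of the weights. -/
theorem extend_smul (hax : PoolingAxioms D op) {c d : ℝ} (hc : c ∈ D) (hd : d ∈ D)
    {f : ℝ × ℝ → ℝ}
    (hcont : ContinuousOn f {x : ℝ × ℝ | 0 ≤ x.1 ∧ 0 ≤ x.2 ∧ x ≠ (0, 0)})
    (hf : ∀ w₁ > (0 : ℝ), ∀ w₂ > (0 : ℝ), f (w₁, w₂) = (op (d, w₁) (c, w₂)).1)
    (hf₁ : ∀ w₁ > (0 : ℝ), f (w₁, 0) = d) (hf₂ : ∀ w₂ > (0 : ℝ), f (0, w₂) = c)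
    {x y k : ℝ} (hx : 0 ≤ x) (hy : 0 ≤ y) (hxy : 0 < x + y) (hk : 0 < k) :
    f (k * x, k * y) = f (x, y) := by
  have hfD : ∀ {x y : ℝ}, 0 ≤ x → 0 ≤ y → 0 < x + y → f (x, y) ∈ D := by
    intro x y hx hy hxy
    rcases hx.eq_or_lt with rfl | hx
    · rwa [hf₂ y (by linarith)]
    rcases hy.eq_or_lt with rfl | hy
    · rwa [hf₁ x hx]
    · rw [hf x hx y hy]; exact hax.mem d hd c hc x hx y hy
  have hnat : ∀ (n : ℕ) {x y : ℝ}, 0 ≤ x → 0 ≤ y → 0 < x + y →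
      f ((n + 1) * x, (n + 1) * y) = f (x, y) := by
    intro n x y hx hy hxy
    induction n with
    | zero => simp
    | succ n ih =>
      have hs : 0 < ((n : ℝ) + 1) * x + (n + 1) * y := by
        rw [← mul_add]; positivity
      have h := hax.op_extend_add hc hd hf hf₁ hf₂ (x := (n + 1) * x) (y := (n + 1) * y)
        (by positivity) (by positivity) hs hx hy hxy
      rw [ih] at h
      have h' := congrArg Prod.fst h
      rw [hax.idem _ (hfD hx hy hxy) _ hs _ hxy] at h'
      push_cast
      rw [h']
      congr 2 <;> ring
  have hrat : EqOn (fun k : ℝ => f (k * x, k * y)) (fun _ => f (x, y))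
      (Ioi 0 ∩ range ((↑) : ℚ → ℝ)) := by
    rintro _ ⟨hq, q, rfl⟩
    have hq : 0 < q := by simpa using hq
    obtain ⟨m, hm⟩ : ∃ m : ℕ, q.num = m + 1 :=
      ⟨(q.num - 1).toNat, by have := Rat.num_pos.2 hq; omega⟩
    obtain ⟨n, hn⟩ : ∃ n : ℕ, q.den = n + 1 := ⟨q.den - 1, by have := q.den_pos; omega⟩
    have hqR : (0 : ℝ) < q := by exact_mod_cast hq
    have hmul : ((n : ℝ) + 1) * q = m + 1 := by
      have := Rat.den_mul_eq_num q
      rw [hm, hn] at this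
      exact_mod_cast congrArg ((↑) : ℚ → ℝ) this
    simp only
    rw [← hnat n (x := q * x) (y := q * y) (by positivity) (by positivity)
      (by rw [← mul_add]; positivity), ← mul_assoc, ← mul_assoc, hmul, hnat m hx hy hxy]
  refine hrat.of_subset_closure ?_ continuousOn_const inter_subset_left
    ((Rat.denseRange_cast (𝕜 := ℝ)).open_subset_closure_inter isOpen_Ioi) hk
  refine hcont.comp (by fun_prop) fun k (hk : 0 < k) => ⟨by positivity, by positivity, ?_⟩
  intro h0
  have h1 : k * x = 0 := congrArg Prod.fst h0
  have h2 : k * y = 0 := congrArg Prod.snd h0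
  have : 0 < k * (x + y) := by positivity
  linarith

/-- The pools of two distinct forecasts form an affinely parametrized arc. -/
theorem exists_path (hax : PoolingAxioms D op) {c d : ℝ} (hc : c ∈ D) (hd : d ∈ D)
    (hcd : c < d) :
    ∃ φ : ℝ → ℝ, StrictMonoOn φ (Icc 0 1) ∧ φ '' Icc 0 1 = Icc c d ∧ φ 0 = c ∧ φ 1 = d ∧
      ∀ s ∈ Icc (0 : ℝ) 1, ∀ t ∈ Icc (0 : ℝ) 1, ∀ w₁ > (0 : ℝ), ∀ w₂ > (0 : ℝ),
        (op (φ s, w₁) (φ t, w₂)).1 = φ ((w₁ * s + w₂ * t) / (w₁ + w₂)) := by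
  obtain ⟨f, hcont, hf, hf₁, hf₂⟩ := hax.continuity d hd c hc
  have h0 : f (0, 1 - 0) = c := hf₂ _ (by norm_num)
  have h1 : f (1, 1 - 1) = d := by rw [sub_self]; exact hf₁ 1 one_pos
  have hφc : ContinuousOn (fun t : ℝ => f (t, 1 - t)) (Icc 0 1) := by
    refine hcont.comp (by fun_prop) fun t ht => ⟨ht.1, sub_nonneg.2 ht.2, fun h => ?_⟩
    have h₁ : t = 0 := congrArg Prod.fst h
    have h₂ : 1 - t = 0 := congrArg Prod.snd h
    linarith
  have hφm : StrictMonoOn (fun t : ℝ => f (t, 1 - t)) (Icc 0 1) := by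
    refine StrictMonoOn.Icc_of_Ioo ?_ hφc
    refine (hax.mono 1 one_pos d hd c hc hcd).congr fun t ht => ?_
    exact (hf t ht.1 (1 - t) (sub_pos.2 ht.2)).symm
  refine ⟨fun t => f (t, 1 - t), hφm, ?_, h0, h1, ?_⟩
  · rw [hφc.image_Icc_of_monotoneOn zero_le_one hφm.monotoneOn, h0, h1]
  intro s hs t ht w₁ hw₁ w₂ hw₂
  have hs' := sub_nonneg.2 hs.2
  have ht' := sub_nonneg.2 ht.2
  have hw : 0 < w₁ + w₂ := by positivity
  have hadd := hax.op_extend_add hc hd hf hf₁ hf₂ (x := w₁ * s) (y := w₁ * (1 - s))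
    (x' := w₂ * t) (y' := w₂ * (1 - t)) (mul_nonneg hw₁.le hs.1) (mul_nonneg hw₁.le hs')
    (by linarith) (mul_nonneg hw₂.le ht.1) (mul_nonneg hw₂.le ht') (by linarith)
  rw [hax.extend_smul hc hd hcont hf hf₁ hf₂ hs.1 hs' (by linarith) hw₁,
    hax.extend_smul hc hd hcont hf hf₁ hf₂ ht.1 ht' (by linarith) hw₂,
    show w₁ * s + w₁ * (1 - s) = w₁ by ring, show w₂ * t + w₂ * (1 - t) = w₂ by ring] at hadd
  have hst : 0 ≤ w₁ * s + w₂ * t :=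
    add_nonneg (mul_nonneg hw₁.le hs.1) (mul_nonneg hw₂.le ht.1)
  have hst' : 0 ≤ w₁ * (1 - s) + w₂ * (1 - t) :=
    add_nonneg (mul_nonneg hw₁.le hs') (mul_nonneg hw₂.le ht')
  have hsm := hax.extend_smul hc hd hcont hf hf₁ hf₂ hst hst' (by linarith) (inv_pos.2 hw)
  rw [congrArg Prod.fst hadd]
  simp only
  rw [← hsm]
  congr 2 <;> field_simp
  ring

/-- Between two points of the domain there is a quasi-mean, and every other one is affine in it. -/
theorem exists_isQuasiMean_Icc (hax : PoolingAxioms D op) {c d : ℝ} (hc : c ∈ D) (hd : d ∈ D)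
    (hcd : c < d) :
    (∀ p₁ ∈ Icc c d, ∀ p₂ ∈ Icc c d, ∀ w₁ > (0 : ℝ), ∀ w₂ > (0 : ℝ),
        (op (p₁, w₁) (p₂, w₂)).1 ∈ Icc c d) ∧
      ∃ τ : ℝ → ℝ, StrictMonoOn τ (Icc c d) ∧ IsQuasiMean op (Icc c d) τ ∧
        ∀ h, IsQuasiMean op (Icc c d) h → ∀ p ∈ Icc c d, h p = h c + τ p * (h d - h c) := by
  obtain ⟨φ, hm, himg, h0, h1, hop⟩ := hax.exists_path hc hd hcd
  have hmean : ∀ s ∈ Icc (0 : ℝ) 1, ∀ t ∈ Icc (0 : ℝ) 1, ∀ w₁ > (0 : ℝ), ∀ w₂ > (0 : ℝ),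
      (w₁ * s + w₂ * t) / (w₁ + w₂) ∈ Icc (0 : ℝ) 1 := by
    intro s hs t ht w₁ hw₁ w₂ hw₂
    have hs' := mul_le_mul_of_nonneg_left hs.2 hw₁.le
    have ht' := mul_le_mul_of_nonneg_left ht.2 hw₂.le
    exact ⟨div_nonneg (add_nonneg (mul_nonneg hw₁.le hs.1) (mul_nonneg hw₂.le ht.1))
      (by positivity), (div_le_one (by positivity)).2 (by linarith)⟩
  have hτ : LeftInvOn (Function.invFunOn φ (Icc 0 1)) φ (Icc 0 1) := hm.injOn.leftInvOn_invFunOn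
  rw [← himg]
  refine ⟨?_, Function.invFunOn φ (Icc 0 1), ?_, ?_, ?_⟩
  · rintro _ ⟨s, hs, rfl⟩ _ ⟨t, ht, rfl⟩ w₁ hw₁ w₂ hw₂
    rw [hop s hs t ht w₁ hw₁ w₂ hw₂]
    exact mem_image_of_mem _ (hmean s hs t ht w₁ hw₁ w₂ hw₂)
  · rintro _ ⟨s, hs, rfl⟩ _ ⟨t, ht, rfl⟩ hst
    rw [hτ hs, hτ ht]
    exact (hm.lt_iff_lt hs ht).1 hst
  · rintro _ ⟨s, hs, rfl⟩ _ ⟨t, ht, rfl⟩ w₁ hw₁ w₂ hw₂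
    rw [hop s hs t ht w₁ hw₁ w₂ hw₂, hτ hs, hτ ht, hτ (hmean s hs t ht w₁ hw₁ w₂ hw₂)]
  · rintro h hh _ ⟨t, ht, rfl⟩
    rw [hτ ht]
    rcases ht.1.eq_or_lt with rfl | ht0
    · rw [h0]; ring
    rcases ht.2.eq_or_lt with rfl | ht1
    · rw [h1]; ring
    have hz : (0 : ℝ) ∈ Icc (0 : ℝ) 1 := by simp
    have ho : (1 : ℝ) ∈ Icc (0 : ℝ) 1 := by simp
    have := hh _ (mem_image_of_mem φ ho) _ (mem_image_of_mem φ hz) t ht0 (1 - t) (sub_pos.2 ht1)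
    rw [hop 1 ho 0 hz t ht0 (1 - t) (sub_pos.2 ht1),
      show t + (1 - t) = 1 by ring, show (t * 1 + (1 - t) * 0) / 1 = t by ring, h0, h1] at this
    rw [this]; ring

/-- The quasi-mean on an interval is unique once normalized at two points. -/
theorem exists_isQuasiMean_normalized (hax : PoolingAxioms D op) {a b c d : ℝ} (hc : c ∈ D)
    (hd : d ∈ D) (hab : a < b) (hca : c ≤ a) (hbd : b ≤ d) :
    ∃ τ : ℝ → ℝ, StrictMonoOn τ (Icc c d) ∧ IsQuasiMean op (Icc c d) τ ∧ τ a = 0 ∧ τ b = 1 ∧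
      ∀ h, IsQuasiMean op (Icc c d) h → h a = 0 → h b = 1 → EqOn h τ (Icc c d) := by
  obtain ⟨-, τ, hm, hq, haff⟩ :=
    hax.exists_isQuasiMean_Icc hc hd (hca.trans_lt (hab.trans_le hbd))
  have ha : a ∈ Icc c d := ⟨hca, hab.le.trans hbd⟩
  have hb : b ∈ Icc c d := ⟨hca.trans hab.le, hbd⟩
  have hpos : 0 < τ b - τ a := sub_pos.2 (hm ha hb hab)
  refine ⟨fun p => (τ p - τ a) / (τ b - τ a), ?_, ?_, by simp, div_self hpos.ne', ?_⟩
  · intro p hp q hq hpq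
    have := hm hp hq hpq
    simp only
    gcongr
  · intro p₁ hp₁ p₂ hp₂ w₁ hw₁ w₂ hw₂
    have hw : 0 < w₁ + w₂ := by positivity
    simp only
    rw [hq p₁ hp₁ p₂ hp₂ w₁ hw₁ w₂ hw₂]
    field_simp
    ring
  · intro h hh h0 h1 p hp
    have e := haff h hh p hp
    have ea := haff h hh a ha
    have eb := haff h hh b hb
    simp only
    rw [eq_div_iff hpos.ne']
    rw [h0] at ea
    rw [h1] at eb
    linear_combination (τ b - τ a) * e + (τ a - τ p) * eb - (τ b - τ p) * ea

theorem exists_isQuasiMean (hax : PoolingAxioms D op) (hne : ∃ a ∈ D, ∃ b ∈ D, a ≠ b) :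
    ∃ g : ℝ → ℝ, StrictMonoOn g D ∧ IsQuasiMean op D g := by
  obtain ⟨a, ha, b, hb, hab⟩ : ∃ a ∈ D, ∃ b ∈ D, a < b := by
    obtain ⟨a, ha, b, hb, hab⟩ := hne
    rcases hab.lt_or_gt with h | h
    exacts [⟨a, ha, b, hb, h⟩, ⟨b, hb, a, ha, h⟩]
  have hmin : ∀ {p q}, p ∈ D → q ∈ D → min p q ∈ D := fun {p q} hp hq => by
    rcases min_choice p q with h | h <;> rwa [h]
  have hmax : ∀ {p q}, p ∈ D → q ∈ D → max p q ∈ D := fun {p q} hp hq => by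
    rcases max_choice p q with h | h <;> rwa [h]
  have key := fun p (hp : p ∈ D) => hax.exists_isQuasiMean_normalized (hmin ha hp) (hmax hb hp)
    hab (min_le_left a p) (le_max_left b p)
  choose! τ _ _ _ _ huniq using key
  have agree : ∀ {c d}, c ∈ D → d ∈ D → c ≤ a → b ≤ d → ∃ σ : ℝ → ℝ,
      StrictMonoOn σ (Icc c d) ∧ IsQuasiMean op (Icc c d) σ ∧
      ∀ p ∈ D, p ∈ Icc c d → τ p p = σ p := by
    intro c d hc hd hca hbd
    obtain ⟨σ, hm, hq, h0, h1, -⟩ := hax.exists_isQuasiMean_normalized hc hd hab hca hbd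
    refine ⟨σ, hm, hq, fun p hp hpcd => ?_⟩
    have hsub : Icc (min a p) (max b p) ⊆ Icc c d :=
      Icc_subset_Icc (le_min hca hpcd.1) (max_le hbd hpcd.2)
    exact (huniq p hp σ (fun p₁ h₁ p₂ h₂ => hq p₁ (hsub h₁) p₂ (hsub h₂)) h0 h1
      ⟨min_le_right a p, le_max_right b p⟩).symm
  have common : ∀ {p q}, p ∈ D → q ∈ D → ∃ c ∈ D, ∃ d ∈ D, c ≤ a ∧ b ≤ d ∧
      p ∈ Icc c d ∧ q ∈ Icc c d := fun {p q} hp hq =>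
    ⟨_, hmin ha (hmin hp hq), _, hmax hb (hmax hp hq), by simp, by simp, by simp, by simp⟩
  refine ⟨fun p => τ p p, ?_, ?_⟩
  · intro p hp q hq hpq
    obtain ⟨c, hc, d, hd, hca, hbd, hpI, hqI⟩ := common hp hq
    obtain ⟨σ, hm, -, he⟩ := agree hc hd hca hbd
    simp only
    rw [he p hp hpI, he q hq hqI]
    exact hm hpI hqI hpq
  · intro p hp q hq w₁ hw₁ w₂ hw₂
    obtain ⟨c, hc, d, hd, hca, hbd, hpI, hqI⟩ := common hp hq
    obtain ⟨σ, -, hσ, he⟩ := agree hc hd hca hbd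
    simp only
    rw [he p hp hpI, he q hq hqI, he _ (hax.mem p hp q hq w₁ hw₁ w₂ hw₂)
      ((hax.exists_isQuasiMean_Icc hc hd (hca.trans_lt (hab.trans_le hbd))).1
        p hpI q hqI w₁ hw₁ w₂ hw₂), hσ p hpI q hqI w₁ hw₁ w₂ hw₂]

end PoolingAxioms

theorem StrictMonoOn.continuousOn_of_ordConnected_image {s : Set ℝ} {g : ℝ → ℝ}
    (hg : StrictMonoOn g s) (hs : s.OrdConnected) (himg : (g '' s).OrdConnected) :
    ContinuousOn g s := by
  rw [continuousOn_iff_continuous_domRestrict]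
  exact continuous_subtype_val.comp (hg.orderIso g s).continuous

/-- A quasi-mean which is strictly increasing is continuous. -/
theorem PoolingAxioms.continuousOn_of_isQuasiMean {D : Set ℝ} {op : ℝ × ℝ → ℝ × ℝ → ℝ × ℝ}
    (hax : PoolingAxioms D op) (hD : D.OrdConnected) {g : ℝ → ℝ} (hg : StrictMonoOn g D)
    (hq : IsQuasiMean op D g) : ContinuousOn g D := by
  refine hg.continuousOn_of_ordConnected_image hD (ordConnected_of_Ioo ?_)
  rintro _ ⟨p, hp, rfl⟩ _ ⟨q, hq', rfl⟩ - z ⟨hpz, hzq⟩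
  have h₁ := sub_pos.2 hzq
  have h₂ := sub_pos.2 hpz
  refine ⟨_, hax.mem p hp q hq' _ h₁ _ h₂, ?_⟩
  rw [hq p hp q hq' _ h₁ _ h₂, div_eq_iff (by linarith)]
  ring

/-- every pooling operator on a two-outcome forecast domain `𝒟 ⊆ [0,1]`
(an interval with more than one point) satisfying the six axioms is the QA pooling
operator `⊕_g` for some continuous, strictly increasing `g : 𝒟 → ℝ`. -/
theorem stmt_11 (D : Set ℝ) (hDsub : D ⊆ Set.Icc 0 1) (hDconv : Convex ℝ D)
    (hne : ∃ a ∈ D, ∃ b ∈ D, a ≠ b)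
    (op : ℝ × ℝ → ℝ × ℝ → ℝ × ℝ) (hax : PoolingAxioms D op) :
    ∃ g : ℝ → ℝ, ContinuousOn g D ∧ StrictMonoOn g D ∧
      ∀ p₁ ∈ D, ∀ p₂ ∈ D, ∀ w₁ > (0:ℝ), ∀ w₂ > (0:ℝ),
        op (p₁, w₁) (p₂, w₂) = qaPool g D (p₁, w₁) (p₂, w₂) := by
  obtain ⟨g, hg, hq⟩ := hax.exists_isQuasiMean hne
  refine ⟨g, hax.continuousOn_of_isQuasiMean hDconv.ordConnected hg hq, hg, ?_⟩
  intro p₁ hp₁ p₂ hp₂ w₁ hw₁ w₂ hw₂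
  refine Prod.ext ?_ (hax.weight_add p₁ hp₁ p₂ hp₂ w₁ hw₁ w₂ hw₂)
  simp only [qaPool]
  rw [← hq p₁ hp₁ p₂ hp₂ w₁ hw₁ w₂ hw₂]
  exact (hg.injOn.leftInvOn_invFunOn (hax.mem p₁ hp₁ p₂ hp₂ w₁ hw₁ w₂ hw₂)).symm
end

section
/- Let 𝒟 ⊆ [0,1] be an interval containing more than one point and let g₁, g₂ : 𝒟 → ℝ be continuous, strictly increasing functions. Then the QA pooling operators ⊕_{g₁} and ⊕_{g₂} coincide (as binary operations on 𝒟 × ℝ_{>0}) if and only if there exist a > 0 and b ∈ ℝ such that g₂(p) = a·g₁(p) + b for all p ∈ 𝒟. -/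
/-- The weighted mean of two values of a continuous function on a convex set is attained. -/
theorem weighted_mean_mem_image {D : Set ℝ} (hD : Convex ℝ D) {g : ℝ → ℝ}
    (hg : ContinuousOn g D) {p q v w : ℝ} (hp : p ∈ D) (hq : q ∈ D) (hv : 0 < v) (hw : 0 < w) :
    (v * g p + w * g q) / (v + w) ∈ g '' D := by
  have hconv : Convex ℝ (g '' D) := (hD.isPreconnected.image g hg).ordConnected.convex
  have h := hconv (Set.mem_image_of_mem g hp) (Set.mem_image_of_mem g hq)
    (div_nonneg hv.le (add_pos hv hw).le) (div_nonneg hw.le (add_pos hv hw).le)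
    (by rw [← add_div, div_self (add_pos hv hw).ne'])
  convert h using 1
  simp only [smul_eq_mul]
  ring

theorem invFunOn_eq_iff {D : Set ℝ} {g : ℝ → ℝ} (hg : Set.InjOn g D) {x y : ℝ}
    (hy : y ∈ g '' D) (hx : x ∈ D) : Function.invFunOn g D y = x ↔ g x = y := by
  constructor
  · rintro rfl
    exact Function.invFunOn_eq hy
  · intro h
    exact hg (Function.invFunOn_mem hy) hx ((Function.invFunOn_eq hy).trans h.symm)

/-- If two generators induce the same pooling operator, then their values at three points
`x < y < z` are affinely related. -/
theorem collinear_of_qaPool_eq {D : Set ℝ} (hD : Convex ℝ D) {g₁ g₂ : ℝ → ℝ}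
    (hg₁ : ContinuousOn g₁ D) (hmono₁ : StrictMonoOn g₁ D)
    (hg₂ : ContinuousOn g₂ D) (hmono₂ : StrictMonoOn g₂ D)
    (h : ∀ p₁ ∈ D, ∀ p₂ ∈ D, ∀ w₁ > (0 : ℝ), ∀ w₂ > (0 : ℝ),
      qaPool g₁ D (p₁, w₁) (p₂, w₂) = qaPool g₂ D (p₁, w₁) (p₂, w₂))
    {x y z : ℝ} (hx : x ∈ D) (hy : y ∈ D) (hz : z ∈ D) (hxy : x < y) (hyz : y < z) :
    (g₁ z - g₁ x) * g₂ y = (g₁ z - g₁ y) * g₂ x + (g₁ y - g₁ x) * g₂ z := by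
  have hv : 0 < g₁ z - g₁ y := sub_pos.2 (hmono₁ hy hz hyz)
  have hw : 0 < g₁ y - g₁ x := sub_pos.2 (hmono₁ hx hy hxy)
  have hs : g₁ z - g₁ y + (g₁ y - g₁ x) ≠ 0 := (add_pos hv hw).ne'
  have hpool := congrArg Prod.fst (h x hx z hz _ hv _ hw)
  simp only [qaPool] at hpool
  have hpool₁ := (invFunOn_eq_iff hmono₁.injOn
    (weighted_mean_mem_image hD hg₁ hx hz hv hw) hy).2 (by rw [eq_div_iff hs]; ring)
  have hpool₂ := (invFunOn_eq_iff hmono₂.injOn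
    (weighted_mean_mem_image hD hg₂ hx hz hv hw) hy).1 (hpool.symm.trans hpool₁)
  rw [eq_div_iff hs] at hpool₂
  linarith

/-- two continuous, strictly increasing functions `g₁, g₂` on a
two-outcome forecast domain (an interval `𝒟 ⊆ [0,1]` with more than one point) induce
the same QA pooling operator on `𝒟 × ℝ_{>0}` iff `g₂ = a·g₁ + b` on `𝒟` for some
`a > 0` and `b ∈ ℝ`. -/
theorem stmt_12 (D : Set ℝ) (hDsub : D ⊆ Set.Icc 0 1) (hDconv : Convex ℝ D)
    (hne : ∃ a ∈ D, ∃ b ∈ D, a ≠ b)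
    (g₁ g₂ : ℝ → ℝ) (hg₁ : ContinuousOn g₁ D) (hmono₁ : StrictMonoOn g₁ D)
    (hg₂ : ContinuousOn g₂ D) (hmono₂ : StrictMonoOn g₂ D) :
    (∀ p₁ ∈ D, ∀ p₂ ∈ D, ∀ w₁ > (0:ℝ), ∀ w₂ > (0:ℝ),
        qaPool g₁ D (p₁, w₁) (p₂, w₂) = qaPool g₂ D (p₁, w₁) (p₂, w₂)) ↔
      ∃ a > (0:ℝ), ∃ b : ℝ, ∀ p ∈ D, g₂ p = a * g₁ p + b := by
  constructor
  · intro h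
    obtain ⟨s, hs, t, ht, hst⟩ : ∃ s ∈ D, ∃ t ∈ D, s < t := by
      obtain ⟨a, ha, b, hb, hab⟩ := hne
      rcases hab.lt_or_gt with hlt | hlt
      exacts [⟨a, ha, b, hb, hlt⟩, ⟨b, hb, a, ha, hlt⟩]
    have hpos₁ : 0 < g₁ t - g₁ s := sub_pos.2 (hmono₁ hs ht hst)
    have hpos₂ : 0 < g₂ t - g₂ s := sub_pos.2 (hmono₂ hs ht hst)
    have hcol {x y z : ℝ} := @collinear_of_qaPool_eq D hDconv g₁ g₂ hg₁ hmono₁ hg₂ hmono₂ h x y z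
    refine ⟨(g₂ t - g₂ s) / (g₁ t - g₁ s), div_pos hpos₂ hpos₁,
      g₂ s - (g₂ t - g₂ s) / (g₁ t - g₁ s) * g₁ s, fun p hp => ?_⟩
    have key : (g₁ t - g₁ s) * (g₂ p - g₂ s) = (g₂ t - g₂ s) * (g₁ p - g₁ s) := by
      rcases lt_trichotomy p s with hps | rfl | hsp
      · linarith [hcol hp hs ht hps hst]
      · ring
      · rcases lt_trichotomy p t with hpt | rfl | htp
        · linarith [hcol hs hp ht hsp hpt]
        · ring
        · linarith [hcol hs ht hp hst htp]
    field_simp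
    linarith
  · rintro ⟨a, -, b, hab⟩ p hp q hq v hv w hw
    have hmean₁ := weighted_mean_mem_image hDconv hg₁ hp hq hv hw
    refine Prod.ext ?_ rfl
    simp only [qaPool]
    refine ((invFunOn_eq_iff hmono₂.injOn (weighted_mean_mem_image hDconv hg₂ hp hq hv hw)
      (Function.invFunOn_mem hmean₁)).2 ?_).symm
    rw [hab _ (Function.invFunOn_mem hmean₁), Function.invFunOn_eq hmean₁, hab p hp, hab q hq]
    have := (add_pos hv hw).ne'
    field_simp
    ring
end

section
/- Let 𝒟 ⊆ [0,1] be an interval containing more than one point and let ⊕ be a pooling operator on 𝒟 × ℝ_{>0} satisfying weight additivity, commutativity, associativity, continuity, and idempotence. Then ⊕ is scale invariant (the distributive property holds): for all (p₁,w₁), (p₂,w₂) ∈ 𝒟 × ℝ_{>0} and all c > 0, (p₁, c·w₁) ⊕ (p₂, c·w₂) = (q, c·(w₁+w₂)), where (q, w₁+w₂) = (p₁,w₁) ⊕ (p₂,w₂); equivalently pr((p₁,cw₁)⊕(p₂,cw₂)) = pr((p₁,w₁)⊕(p₂,w₂)). -/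
/-- any pooling operator on a two-outcome forecast domain `𝒟 ⊆ [0,1]`
(an interval with more than one point) satisfying weight additivity, commutativity,
associativity, continuity, and idempotence is scale invariant (the distributive
property): scaling both weights by `c > 0` scales the output weight by `c` and leaves
the pooled probability unchanged. -/
theorem stmt_13 (D : Set ℝ) (hDsub : D ⊆ Set.Icc 0 1) (hDconv : Convex ℝ D)
    (hne : ∃ a ∈ D, ∃ b ∈ D, a ≠ b)
    (op : ℝ × ℝ → ℝ × ℝ → ℝ × ℝ)
    (hmem : ∀ p₁ ∈ D, ∀ p₂ ∈ D, ∀ w₁ > (0:ℝ), ∀ w₂ > (0:ℝ),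
      (op (p₁, w₁) (p₂, w₂)).1 ∈ D)
    (hadd : ∀ p₁ ∈ D, ∀ p₂ ∈ D, ∀ w₁ > (0:ℝ), ∀ w₂ > (0:ℝ),
      (op (p₁, w₁) (p₂, w₂)).2 = w₁ + w₂)
    (hcomm : ∀ p₁ ∈ D, ∀ p₂ ∈ D, ∀ w₁ > (0:ℝ), ∀ w₂ > (0:ℝ),
      op (p₁, w₁) (p₂, w₂) = op (p₂, w₂) (p₁, w₁))
    (hassoc : ∀ p₁ ∈ D, ∀ p₂ ∈ D, ∀ p₃ ∈ D, ∀ w₁ > (0:ℝ), ∀ w₂ > (0:ℝ), ∀ w₃ > (0:ℝ),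
      op (p₁, w₁) (op (p₂, w₂) (p₃, w₃)) = op (op (p₁, w₁) (p₂, w₂)) (p₃, w₃))
    (hcont : ∀ p₁ ∈ D, ∀ p₂ ∈ D, ∃ f : ℝ × ℝ → ℝ,
      ContinuousOn f {x : ℝ × ℝ | 0 ≤ x.1 ∧ 0 ≤ x.2 ∧ x ≠ (0, 0)} ∧
      (∀ w₁ > (0:ℝ), ∀ w₂ > (0:ℝ), f (w₁, w₂) = (op (p₁, w₁) (p₂, w₂)).1) ∧
      (∀ w₁ > (0:ℝ), f (w₁, 0) = p₁) ∧ (∀ w₂ > (0:ℝ), f (0, w₂) = p₂))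
    (hidem : ∀ p ∈ D, ∀ w₁ > (0:ℝ), ∀ w₂ > (0:ℝ), (op (p, w₁) (p, w₂)).1 = p) :
    ∀ p₁ ∈ D, ∀ p₂ ∈ D, ∀ w₁ > (0:ℝ), ∀ w₂ > (0:ℝ), ∀ c > (0:ℝ),
      op (p₁, c * w₁) (p₂, c * w₂) =
        ((op (p₁, w₁) (p₂, w₂)).1, c * (w₁ + w₂)) := by
  intro p₁ h₁ p₂ h₂ w₁ hw₁ w₂ hw₂ c hc
  have same : ∀ p ∈ D, ∀ u > (0:ℝ), ∀ v > (0:ℝ), op (p, u) (p, v) = (p, u + v) :=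
    fun p hp u hu v hv => Prod.ext (hidem p hp u hu v hv) (hadd p hp p hp u hu v hv)
  have pair : ∀ u > (0:ℝ), ∀ v > (0:ℝ),
      op (p₁, u) (p₂, v) = ((op (p₁, u) (p₂, v)).1, u + v) :=
    fun u hu v hv => Prod.ext rfl (hadd p₁ h₁ p₂ h₂ u hu v hv)
  have interchange : ∀ u > (0:ℝ), ∀ v > (0:ℝ), ∀ u' > (0:ℝ), ∀ v' > (0:ℝ),
      op (p₁, u + u') (p₂, v + v') =
        op (op (p₁, u) (p₂, v)) (op (p₁, u') (p₂, v')) := by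
    intro u hu v hv u' hu' v' hv'
    have hq := hmem p₁ h₁ p₂ h₂ u' hu' v' hv'
    have hr := hmem p₁ h₁ p₂ h₂ u' hu' (v + v') (by linarith)
    calc op (p₁, u + u') (p₂, v + v')
        = op (p₁, u) (op (p₁, u') (p₂, v + v')) := by
          rw [← same p₁ h₁ u hu u' hu',
            hassoc p₁ h₁ p₁ h₁ p₂ h₂ u hu u' hu' (v + v') (by linarith)]
      _ = op (p₁, u) (op (p₂, v) (op (p₁, u') (p₂, v'))) := by
          congr 1
          rw [← same p₂ h₂ v hv v' hv', hassoc p₁ h₁ p₂ h₂ p₂ h₂ u' hu' v hv v' hv',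
            hcomm p₁ h₁ p₂ h₂ u' hu' v hv, hassoc p₂ h₂ p₁ h₁ p₂ h₂ v hv u' hu' v' hv']
      _ = op (op (p₁, u) (p₂, v)) (op (p₁, u') (p₂, v')) := by
          rw [pair u' hu' v' hv',
            hassoc p₁ h₁ p₂ h₂ _ hq u hu v hv (u' + v') (by linarith)]
  have nat_scale : ∀ u > (0:ℝ), ∀ v > (0:ℝ), ∀ n : ℕ, 0 < n →
      (op (p₁, n * u) (p₂, n * v)).1 = (op (p₁, u) (p₂, v)).1 := by
    intro u hu v hv n hn
    induction n, hn using Nat.le_induction with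
    | base => simp
    | succ n hn ih =>
      have hn' : (0:ℝ) < n := by exact_mod_cast hn
      have hnu := mul_pos hn' hu
      have hnv := mul_pos hn' hv
      push_cast
      rw [add_mul, add_mul, one_mul, one_mul, interchange _ hnu _ hnv u hu v hv,
        pair _ hnu _ hnv, pair u hu v hv, ih]
      exact hidem _ (hmem p₁ h₁ p₂ h₂ u hu v hv) _ (by linarith) _ (by linarith)
  obtain ⟨f, hf, hfop, -, -⟩ := hcont p₁ h₁ p₂ h₂
  have rat_scale : ∀ k n : ℕ, 0 < k → 0 < n →
      f ((k / n : ℝ) * w₁, (k / n : ℝ) * w₂) = f (w₁, w₂) := by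
    intro k n hk hn
    have hk' : (0:ℝ) < k := by exact_mod_cast hk
    have hn' : (0:ℝ) < n := by exact_mod_cast hn
    have hu : 0 < w₁ / n := by positivity
    have hv : 0 < w₂ / n := by positivity
    have e₁ := nat_scale _ hu _ hv k hk
    have e₂ := nat_scale _ hu _ hv n hn
    rw [mul_div_cancel₀ _ hn'.ne', mul_div_cancel₀ _ hn'.ne'] at e₂
    rw [hfop _ (by positivity) _ (by positivity), hfop _ hw₁ _ hw₂, e₂, ← e₁,
      div_mul_eq_mul_div, div_mul_eq_mul_div, mul_div_assoc, mul_div_assoc]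
  have hscaled : ContinuousAt (fun t : ℝ => f (t * w₁, t * w₂)) c := by
    have hcw₁ := mul_pos hc hw₁
    have hcw₂ := mul_pos hc hw₂
    have hfc : ContinuousAt f (c * w₁, c * w₂) := by
      refine hf.continuousAt (Filter.mem_of_superset
        (prod_mem_nhds (Ioi_mem_nhds hcw₁) (Ioi_mem_nhds hcw₂)) ?_)
      rintro ⟨x, y⟩ ⟨hx, hy⟩
      exact ⟨le_of_lt hx, le_of_lt hy, fun h => (ne_of_gt hx) (congrArg Prod.fst h)⟩
    exact ContinuousAt.comp (f := fun t : ℝ => (t * w₁, t * w₂)) hfc (by fun_prop)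
  have hceil : Filter.Tendsto (fun n : ℕ => (⌈c * (n : ℝ)⌉₊ : ℝ) / n) Filter.atTop (nhds c) :=
    (tendsto_nat_ceil_mul_div_atTop hc.le).comp tendsto_natCast_atTop_atTop
  have hlim : f (c * w₁, c * w₂) = f (w₁, w₂) := by
    refine tendsto_nhds_unique (hscaled.tendsto.comp hceil) (tendsto_const_nhds.congr' ?_)
    filter_upwards [Filter.eventually_gt_atTop 0] with n hn
    have hn' : (0:ℝ) < n := by exact_mod_cast hn
    exact (rat_scale _ n (Nat.ceil_pos.2 (mul_pos hc hn')) hn).symm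
  have hcw₁ := mul_pos hc hw₁
  have hcw₂ := mul_pos hc hw₂
  rw [pair _ hcw₁ _ hcw₂, ← hfop _ hcw₁ _ hcw₂, ← hfop _ hw₁ _ hw₂, hlim, mul_add]
end

section
/- Let U ⊆ ℝⁿ be a nonempty open convex set and let g : U → ℝⁿ. Then g is continuous and strictly cyclically monotone if and only if there exists a differentiable, strictly convex function G : U → ℝ with ∇G = g on U. -/
open scoped InnerProductSpace BigOperators

/-- `g` is strictly cyclically monotone on `S`: for every cycle `x₀, x₁, …, x_{k−1}, x_k = x₀`
of points of `S`, `Σ_{i=1}^k ⟨g(x_i), x_i − x_{i−1}⟩ ≥ 0`, with strict inequality unless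
`x₀ = x₁ = … = x_{k−1}`. -/
def StrictCyclMono {n : ℕ} (S : Set (EuclideanSpace ℝ (Fin n)))
    (g : EuclideanSpace ℝ (Fin n) → EuclideanSpace ℝ (Fin n)) : Prop :=
  ∀ k : ℕ, 1 ≤ k → ∀ x : ℕ → EuclideanSpace ℝ (Fin n),
    (∀ i, i < k → x i ∈ S) → x k = x 0 →
    (0 ≤ ∑ i ∈ Finset.range k, ⟪g (x (i + 1)), x (i + 1) - x i⟫_ℝ) ∧
    ((∃ i, i < k ∧ x i ≠ x 0) →
      0 < ∑ i ∈ Finset.range k, ⟪g (x (i + 1)), x (i + 1) - x i⟫_ℝ)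

/-- The strict first-order condition: the graph of a strictly convex function lies strictly above
its tangent hyperplanes. -/
theorem StrictConvexOn.add_inner_gradient_lt {E : Type*} [NormedAddCommGroup E]
    [InnerProductSpace ℝ E] [CompleteSpace E] {U : Set E} {G : E → ℝ} (hG : StrictConvexOn ℝ U G)
    {x y p : E} (hx : x ∈ U) (hy : y ∈ U) (hp : HasGradientAt G p x) (hxy : x ≠ y) :
    G x + ⟪p, y - x⟫_ℝ < G y := by
  have weak : ∀ z ∈ U, G x + ⟪p, z - x⟫_ℝ ≤ G z := by
    intro z hz
    have hconv : ConvexOn ℝ ((AffineMap.lineMap x z : ℝ →ᵃ[ℝ] E) ⁻¹' U)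
        (G ∘ (AffineMap.lineMap x z : ℝ →ᵃ[ℝ] E)) := hG.convexOn.comp_affineMap _
    have hder : HasDerivAt (G ∘ (AffineMap.lineMap x z : ℝ →ᵃ[ℝ] E)) ⟪p, z - x⟫_ℝ 0 := by
      have h : HasFDerivAt G (InnerProductSpace.toDual ℝ E p)
          ((AffineMap.lineMap x z : ℝ →ᵃ[ℝ] E) 0) := by
        simpa using hp.hasFDerivAt
      simpa using h.comp_hasDerivAt (0 : ℝ) AffineMap.hasDerivAt_lineMap
    have h := hconv.le_slope_of_hasDerivAt (x := 0) (y := 1) (by simpa using hx)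
      (by simpa using hz) one_pos hder
    simp [slope_def_field] at h
    linarith
  have hmem : (1 / 2 : ℝ) • x + (1 / 2 : ℝ) • y ∈ U :=
    hG.1 hx hy (by norm_num) (by norm_num) (by norm_num)
  have h1 := weak _ hmem
  have h2 := hG.2 hx hy hxy (one_half_pos (α := ℝ)) one_half_pos (add_halves 1)
  have h3 : (1 / 2 : ℝ) • x + (1 / 2 : ℝ) • y - x = (1 / 2 : ℝ) • (y - x) := by module
  rw [h3, inner_smul_right] at h1
  simp only [smul_eq_mul] at h2
  linarith

/-- A gradient field satisfying the first-order convexity condition on an open set is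
continuous. -/
theorem continuousOn_of_hasGradientAt_of_add_inner_le {E : Type*} [NormedAddCommGroup E]
    [InnerProductSpace ℝ E] [CompleteSpace E] {U : Set E} (hU : IsOpen U) {G : E → ℝ} {g : E → E}
    (hG : ∀ x ∈ U, HasGradientAt G (g x) x)
    (hle : ∀ x ∈ U, ∀ y ∈ U, G x + ⟪g x, y - x⟫_ℝ ≤ G y) : ContinuousOn g U := by
  intro x hx
  refine ContinuousAt.continuousWithinAt (Metric.continuousAt_iff'.2 fun ε hε => ?_)
  have ho := (hasGradientAt_iff_isLittleO.1 (hG x hx)).def (c := ε / 4) (by positivity)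
  obtain ⟨δ, hδ, hball⟩ := Metric.eventually_nhds_iff_ball.1 (ho.and (hU.mem_nhds hx))
  filter_upwards [Metric.ball_mem_nhds x (half_pos hδ)] with y hy
  rw [dist_eq_norm]
  have hyx : ‖y - x‖ < δ / 2 := by simpa [dist_eq_norm] using hy
  rcases eq_or_ne (g y - g x) 0 with h0 | h0
  · simpa [h0] using hε
  set w := g y - g x with hw
  have hwpos : 0 < ‖w‖ := norm_pos_iff.2 h0
  set v := (δ / 2 / ‖w‖) • w with hv
  have hvn : ‖v‖ = δ / 2 := by
    rw [hv, norm_smul, Real.norm_of_nonneg (by positivity)]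
    field_simp
  have hzx : ‖y + v - x‖ < δ := by
    calc ‖y + v - x‖ = ‖(y - x) + v‖ := by congr 1; abel
      _ ≤ ‖y - x‖ + ‖v‖ := norm_add_le _ _
      _ < δ := by linarith
  obtain ⟨hoy, hyU⟩ := hball y (by rw [mem_ball_iff_norm]; linarith)
  obtain ⟨hoz, hzU⟩ := hball (y + v) (by rwa [mem_ball_iff_norm])
  have hsub := hle y hyU _ hzU
  have hinner : ⟪w, v⟫_ℝ = δ / 2 * ‖w‖ := by
    rw [hv, inner_smul_right, real_inner_self_eq_norm_sq]
    field_simp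
  have hsplit : ⟪w, v⟫_ℝ = ⟪g y, v⟫_ℝ - ⟪g x, v⟫_ℝ := by rw [hw, inner_sub_left]
  have hsum : ⟪g x, y + v - x⟫_ℝ = ⟪g x, y - x⟫_ℝ + ⟪g x, v⟫_ℝ := by
    rw [← inner_add_right]; congr 1; abel
  rw [Real.norm_eq_abs] at hoy hoz
  have h1 := (abs_le.1 hoy).1
  have h2 := (abs_le.1 hoz).2
  rw [add_sub_cancel_left] at hsub
  have h3 : ε / 4 * ‖y - x‖ ≤ ε / 4 * (δ / 2) := by gcongr
  have h4 : ε / 4 * ‖y + v - x‖ ≤ ε / 4 * δ := by gcongr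
  have h5 : δ / 2 * ‖w‖ ≤ δ / 2 * (3 / 4 * ε) := by
    linarith
  have h6 := le_of_mul_le_mul_left h5 (half_pos hδ)
  linarith

/-- The map `g` is strictly cyclically monotone as soon as it selects strict subgradients. -/
theorem StrictCyclMono.of_add_inner_lt {n : ℕ} {U : Set (EuclideanSpace ℝ (Fin n))}
    {g : EuclideanSpace ℝ (Fin n) → EuclideanSpace ℝ (Fin n)} {G : EuclideanSpace ℝ (Fin n) → ℝ}
    (hlt : ∀ x ∈ U, ∀ y ∈ U, x ≠ y → G x + ⟪g x, y - x⟫_ℝ < G y) : StrictCyclMono U g := by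
  intro k hk x hx hxk
  have hxU : ∀ i ≤ k, x i ∈ U := by
    intro i hi
    rcases hi.lt_or_eq with h | rfl
    · exact hx i h
    · rw [hxk]; exact hx 0 hk
  have htel : ∑ i ∈ Finset.range k, (G (x (i + 1)) - G (x i)) = 0 := by
    rw [Finset.sum_range_sub (fun i => G (x i)), hxk, sub_self]
  have hstrict : ∀ i < k, x (i + 1) ≠ x i →
      G (x (i + 1)) - G (x i) < ⟪g (x (i + 1)), x (i + 1) - x i⟫_ℝ := by
    intro i hi hne
    have h := hlt _ (hxU (i + 1) hi) _ (hxU i hi.le) hne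
    rw [← neg_sub (x (i + 1)), inner_neg_right] at h
    linarith
  have hle : ∀ i ∈ Finset.range k,
      G (x (i + 1)) - G (x i) ≤ ⟪g (x (i + 1)), x (i + 1) - x i⟫_ℝ := by
    intro i hi
    by_cases h : x (i + 1) = x i
    · simp [h]
    · exact (hstrict i (Finset.mem_range.1 hi) h).le
  refine ⟨htel ▸ Finset.sum_le_sum hle, fun ⟨j, hj, hne⟩ => ?_⟩
  have hex : ∃ i < k, x (i + 1) ≠ x i := by
    by_contra! hall
    have hconst : ∀ i ≤ k, x i = x 0 := by
      intro i
      induction i with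
      | zero => simp
      | succ i ih => exact fun hi => (hall i hi).trans (ih (Nat.le_of_succ_le hi))
    exact hne (hconst j hj.le)
  obtain ⟨i, hi, hne⟩ := hex
  rw [← htel]
  exact Finset.sum_lt_sum hle ⟨i, Finset.mem_range.2 hi, hstrict i hi hne⟩

/-- Rockafellar's construction: a cyclically monotone map selects subgradients of some function. -/
theorem StrictCyclMono.exists_add_inner_le {n : ℕ} {U : Set (EuclideanSpace ℝ (Fin n))}
    {g : EuclideanSpace ℝ (Fin n) → EuclideanSpace ℝ (Fin n)} (hg : StrictCyclMono U g) :
    ∃ G : EuclideanSpace ℝ (Fin n) → ℝ,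
      ∀ x ∈ U, ∀ y ∈ U, G x + ⟪g x, y - x⟫_ℝ ≤ G y := by
  rcases U.eq_empty_or_nonempty with rfl | ⟨a, ha⟩
  · exact ⟨0, by simp⟩
  let V : EuclideanSpace ℝ (Fin n) → Set ℝ := fun y =>
    {v | ∃ (k : ℕ) (x : ℕ → EuclideanSpace ℝ (Fin n)), (∀ i ≤ k, x i ∈ U) ∧ x 0 = a ∧ x k = y ∧
      v = ∑ i ∈ Finset.range k, ⟪g (x (i + 1)), x (i + 1) - x i⟫_ℝ}
  have hext : ∀ (k : ℕ) (x : ℕ → EuclideanSpace ℝ (Fin n)) (z : EuclideanSpace ℝ (Fin n)),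
      (∑ i ∈ Finset.range (k + 1), ⟪g (Function.update x (k + 1) z (i + 1)),
        Function.update x (k + 1) z (i + 1) - Function.update x (k + 1) z i⟫_ℝ) =
      (∑ i ∈ Finset.range k, ⟪g (x (i + 1)), x (i + 1) - x i⟫_ℝ) + ⟪g z, z - x k⟫_ℝ := by
    intro k x z
    rw [Finset.sum_range_succ]
    congr 1
    · refine Finset.sum_congr rfl fun i hi => ?_
      have hik := Finset.mem_range.1 hi
      rw [Function.update_of_ne (by omega), Function.update_of_ne (by omega)]
    · rw [Function.update_self, Function.update_of_ne (by omega)]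
  have hstep : ∀ y, ∀ z ∈ U, ∀ v ∈ V y, v + ⟪g z, z - y⟫_ℝ ∈ V z := by
    rintro y z hz v ⟨k, x, hxU, hx0, rfl, rfl⟩
    refine ⟨k + 1, Function.update x (k + 1) z, fun i hi => ?_, ?_, by simp, (hext k x z).symm⟩
    · rcases hi.lt_or_eq with h | rfl
      · rw [Function.update_of_ne h.ne]; exact hxU i (Nat.lt_succ_iff.1 h)
      · rwa [Function.update_self]
    · rw [Function.update_of_ne (by omega), hx0]
  have hne : ∀ y ∈ U, (V y).Nonempty := fun y hy =>
    ⟨_, hstep a y hy 0 ⟨0, fun _ => a, fun _ _ => ha, rfl, rfl, by simp⟩⟩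
  have hbdd : ∀ y, BddBelow (V y) := by
    refine fun y => ⟨-⟪g a, a - y⟫_ℝ, ?_⟩
    rintro v ⟨k, x, hxU, hx0, rfl, rfl⟩
    have h := (hg (k + 1) (by omega) (Function.update x (k + 1) a) (fun i hi => by
      rw [Function.update_of_ne hi.ne]; exact hxU i (Nat.lt_succ_iff.1 hi))
      (by rw [Function.update_self, Function.update_of_ne (by omega), hx0])).1
    rw [hext] at h
    linarith
  refine ⟨fun y => sInf (V y), fun x hx y hy => le_csInf (hne y hy) fun v hv => ?_⟩
  have h := csInf_le (hbdd x) (hstep y x hx v hv)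
  rw [← neg_sub x y, inner_neg_right]
  linarith

/-- A strictly cyclically monotone map is strictly monotone. -/
theorem StrictCyclMono.inner_sub_sub_pos {n : ℕ} {U : Set (EuclideanSpace ℝ (Fin n))}
    {g : EuclideanSpace ℝ (Fin n) → EuclideanSpace ℝ (Fin n)} (hg : StrictCyclMono U g)
    {x y : EuclideanSpace ℝ (Fin n)} (hx : x ∈ U) (hy : y ∈ U) (hxy : x ≠ y) :
    0 < ⟪g y - g x, y - x⟫_ℝ := by
  have h := (hg 2 (by norm_num) (fun i => if i = 1 then y else x)
    (fun i _ => by split_ifs <;> assumption) (by simp)).2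
    ⟨1, by norm_num, by simpa using hxy.symm⟩
  simp only [Finset.sum_range_succ, Finset.sum_range_zero] at h
  norm_num at h
  rw [← neg_sub y x, inner_neg_right] at h
  rw [inner_sub_left]
  linarith

/-- Subgradients of a function on a convex set that are strictly monotone are strict. -/
theorem add_inner_lt_of_add_inner_le {E : Type*} [NormedAddCommGroup E] [InnerProductSpace ℝ E]
    {U : Set E} (hU : Convex ℝ U) {G : E → ℝ} {g : E → E}
    (hle : ∀ x ∈ U, ∀ y ∈ U, G x + ⟪g x, y - x⟫_ℝ ≤ G y)
    (hmono : ∀ x ∈ U, ∀ y ∈ U, x ≠ y → 0 < ⟪g y - g x, y - x⟫_ℝ)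
    {x y : E} (hx : x ∈ U) (hy : y ∈ U) (hxy : x ≠ y) : G x + ⟪g x, y - x⟫_ℝ < G y := by
  set z := (1 / 2 : ℝ) • x + (1 / 2 : ℝ) • y with hz
  have hzU : z ∈ U := hU hx hy (by norm_num) (by norm_num) (by norm_num)
  have hzx : z - x = (1 / 2 : ℝ) • (y - x) := by rw [hz]; module
  have hyz : y - z = (1 / 2 : ℝ) • (y - x) := by rw [hz]; module
  have hne : x ≠ z := by
    intro h
    rw [← h, sub_self, eq_comm, smul_eq_zero, sub_eq_zero] at hzx
    exact hzx.elim (by norm_num) hxy.symm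
  have h1 := hle x hx z hzU
  have h2 := hle z hzU y hy
  have h3 := hmono x hx z hzU hne
  rw [hzx, inner_smul_right] at h1 h3
  rw [hyz, inner_smul_right] at h2
  rw [inner_sub_left] at h3
  linarith

/-- A function with strict subgradients on a convex set is strictly convex. -/
theorem strictConvexOn_of_add_inner_lt {E : Type*} [NormedAddCommGroup E] [InnerProductSpace ℝ E]
    {U : Set E} (hU : Convex ℝ U) {G : E → ℝ} {g : E → E}
    (hlt : ∀ x ∈ U, ∀ y ∈ U, x ≠ y → G x + ⟪g x, y - x⟫_ℝ < G y) : StrictConvexOn ℝ U G := by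
  refine ⟨hU, fun x hx y hy hxy a b ha hb hab => ?_⟩
  obtain rfl : a = 1 - b := by linarith
  set z := (1 - b) • x + b • y with hz
  have hzU : z ∈ U := hU hx hy ha.le hb.le hab
  have hxz : x - z = b • (x - y) := by rw [hz]; module
  have hyz : y - z = (-(1 - b)) • (x - y) := by rw [hz]; module
  have hsub : x - y ≠ 0 := sub_ne_zero.2 hxy
  have hne1 : z ≠ x := fun h => smul_ne_zero hb.ne' hsub (by rw [← hxz, h, sub_self])
  have hne2 : z ≠ y := fun h =>
    smul_ne_zero (neg_ne_zero.2 ha.ne') hsub (by rw [← hyz, h, sub_self])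
  have h1 := hlt z hzU x hx hne1
  have h2 := hlt z hzU y hy hne2
  rw [hxz, inner_smul_right] at h1
  rw [hyz, inner_smul_right] at h2
  have h3 := mul_lt_mul_of_pos_left h1 ha
  have h4 := mul_lt_mul_of_pos_left h2 hb
  simp only [smul_eq_mul]
  linarith

/-- A function with a continuous field of subgradients on an open set is differentiable there. -/
theorem hasGradientAt_of_continuousOn_of_add_inner_le {E : Type*} [NormedAddCommGroup E]
    [InnerProductSpace ℝ E] [CompleteSpace E] {U : Set E} (hU : IsOpen U) {G : E → ℝ} {g : E → E}
    (hg : ContinuousOn g U) (hle : ∀ x ∈ U, ∀ y ∈ U, G x + ⟪g x, y - x⟫_ℝ ≤ G y)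
    {x : E} (hx : x ∈ U) : HasGradientAt G (g x) x := by
  rw [hasGradientAt_iff_isLittleO, Asymptotics.isLittleO_iff]
  intro c hc
  have hcont := hg.continuousAt (hU.mem_nhds hx)
  filter_upwards [hU.mem_nhds hx, hcont (Metric.closedBall_mem_nhds (g x) hc)] with y hy hyc
  have hyc : ‖g y - g x‖ ≤ c := by simpa [dist_eq_norm] using hyc
  have h1 := hle x hx y hy
  have h2 := hle y hy x hx
  have h3 := real_inner_le_norm (g y - g x) (y - x)
  rw [← neg_sub y x, inner_neg_right] at h2
  rw [inner_sub_left] at h3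
  have h4 : ‖g y - g x‖ * ‖y - x‖ ≤ c * ‖y - x‖ := by gcongr
  rw [Real.norm_of_nonneg (by linarith)]
  linarith

/-- on a nonempty open convex set `U ⊆ ℝⁿ`, a map `g : U → ℝⁿ` is
continuous and strictly cyclically monotone iff it is the gradient of a differentiable,
strictly convex function `G : U → ℝ`. -/
theorem stmt_14 {n : ℕ} (U : Set (EuclideanSpace ℝ (Fin n))) (hne : U.Nonempty)
    (hopen : IsOpen U) (hconv : Convex ℝ U)
    (g : EuclideanSpace ℝ (Fin n) → EuclideanSpace ℝ (Fin n)) :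
    (ContinuousOn g U ∧ StrictCyclMono U g) ↔
      ∃ G : EuclideanSpace ℝ (Fin n) → ℝ, StrictConvexOn ℝ U G ∧
        ∀ x ∈ U, HasGradientAt G (g x) x := by
  constructor
  · rintro ⟨hcont, hg⟩
    obtain ⟨G, hle⟩ := hg.exists_add_inner_le
    refine ⟨G, strictConvexOn_of_add_inner_lt (g := g) hconv fun x hx y hy hxy => ?_, fun x hx =>
      hasGradientAt_of_continuousOn_of_add_inner_le hopen hcont hle hx⟩
    exact add_inner_lt_of_add_inner_le hconv hle
      (fun _ hx _ hy hxy => hg.inner_sub_sub_pos hx hy hxy) hx hy hxy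
  · rintro ⟨G, hG, hgrad⟩
    have hlt : ∀ x ∈ U, ∀ y ∈ U, x ≠ y → G x + ⟪g x, y - x⟫_ℝ < G y :=
      fun x hx y hy hxy => hG.add_inner_gradient_lt hx hy (hgrad x hx) hxy
    refine ⟨continuousOn_of_hasGradientAt_of_add_inner_le hopen hgrad fun x hx y hy => ?_,
      .of_add_inner_lt hlt⟩
    rcases eq_or_ne x y with rfl | hxy
    · simp
    · exact (hlt x hx y hy hxy).le
end

section
/- Let n ≥ 2 and let α > 1 be real. For every p, q ∈ Δⁿ and every w ∈ [0,1], there exist x ∈ Δⁿ and c ∈ ℝ such that for every j ∈ {1,…,n}: (Σ_k x_k^α)^{(1−α)/α} · x_j^{α−1} = w·(Σ_k p_k^α)^{(1−α)/α} · p_j^{α−1} + (1−w)·(Σ_k q_k^α)^{(1−α)/α} · q_j^{α−1} + c. (That is, the spherical scoring rule with parameter α, whose expected reward function is G(p) = (Σ_j p_j^α)^{1/α}, has convex exposure on Δⁿ.) -/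
open scoped BigOperators

/-- The gradient of the spherical score lies on the unit sphere of the dual exponent. -/
theorem sum_spherical_gradient_rpow {ι : Type*} [Fintype ι] {α : ℝ} (hα : 1 < α)
    {p : ι → ℝ} (hp : p ∈ stdSimplex ℝ ι) :
    ∑ j, ((∑ k, p k ^ α) ^ ((1 - α) / α) * p j ^ (α - 1)) ^ (α / (α - 1)) = 1 := by
  have hα0 : α ≠ 0 := by positivity
  have hα1 : α - 1 ≠ 0 := by linarith
  have hS0 : 0 ≤ ∑ k, p k ^ α := Finset.sum_nonneg fun k _ => Real.rpow_nonneg (hp.1 k) _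
  have hS : 0 < ∑ k, p k ^ α := by
    refine hS0.lt_of_ne fun h => ?_
    have hz := (Finset.sum_eq_zero_iff_of_nonneg
      fun k _ => Real.rpow_nonneg (hp.1 k) α).1 h.symm
    have hsum : ∑ k, p k = 0 := Finset.sum_eq_zero fun k hk =>
      (Real.rpow_eq_zero (hp.1 k) hα0).1 (hz k hk)
    linarith [hp.2]
  have hterm (j : ι) : ((∑ k, p k ^ α) ^ ((1 - α) / α) * p j ^ (α - 1)) ^ (α / (α - 1)) =
      (∑ k, p k ^ α)⁻¹ * p j ^ α := by
    rw [Real.mul_rpow (Real.rpow_nonneg hS0 _) (Real.rpow_nonneg (hp.1 j) _),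
      ← Real.rpow_mul hS0, ← Real.rpow_mul (hp.1 j), mul_div_cancel₀ α hα1,
      show (1 - α) / α * (α / (α - 1)) = -1 by field_simp; ring, Real.rpow_neg_one]
  simp_rw [hterm, ← Finset.mul_sum]
  exact inv_mul_cancel₀ (ne_of_gt hS)

/-- Every nonnegative vector on the unit sphere of the dual exponent is a gradient value
of the spherical score. -/
theorem exists_spherical_gradient_eq {ι : Type*} [Fintype ι] {α : ℝ} (hα : 1 < α)
    {u : ι → ℝ} (hu : ∀ j, 0 ≤ u j) (hu1 : ∑ j, u j ^ (α / (α - 1)) = 1) :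
    ∃ x ∈ stdSimplex ℝ ι, ∀ j, (∑ k, x k ^ α) ^ ((1 - α) / α) * x j ^ (α - 1) = u j := by
  have hα0 : α ≠ 0 := by positivity
  have hα1 : 0 < α - 1 := by linarith
  have hy (j : ι) : 0 ≤ u j ^ (α - 1)⁻¹ := Real.rpow_nonneg (hu j) _
  set S := ∑ k, u k ^ (α - 1)⁻¹ with hSdef
  have hS0 : 0 ≤ S := Finset.sum_nonneg fun k _ => hy k
  have hS : 0 < S := by
    refine hS0.lt_of_ne fun h => ?_
    have hz := (Finset.sum_eq_zero_iff_of_nonneg fun k _ => hy k).1 h.symm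
    have hsum : ∑ j, u j ^ (α / (α - 1)) = 0 := Finset.sum_eq_zero fun k hk => by
      rw [(Real.rpow_eq_zero (hu k) (inv_ne_zero hα1.ne')).1 (hz k hk)]
      exact Real.zero_rpow (div_ne_zero hα0 hα1.ne')
    linarith
  refine ⟨fun j => u j ^ (α - 1)⁻¹ / S, ⟨fun j => div_nonneg (hy j) hS0, ?_⟩, fun j => ?_⟩
  · rw [← Finset.sum_div, ← hSdef, div_self hS.ne']
  · have hterm (k : ι) : (u k ^ (α - 1)⁻¹ / S) ^ α = u k ^ (α / (α - 1)) / S ^ α := by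
      rw [Real.div_rpow (hy k) hS0, ← Real.rpow_mul (hu k), inv_mul_eq_div]
    simp_rw [hterm, ← Finset.sum_div, hu1]
    rw [one_div, ← Real.rpow_neg hS0, ← Real.rpow_mul hS0, Real.div_rpow (hy j) hS0,
      ← Real.rpow_mul (hu j), inv_mul_cancel₀ hα1.ne', Real.rpow_one,
      show -α * ((1 - α) / α) = α - 1 by field_simp; ring]
    exact mul_div_cancel₀ _ (ne_of_gt (Real.rpow_pos_of_pos hS _))

/-- A nonnegative vector in the unit ball of exponent `β` can be moved onto the unit sphere
by adding a nonnegative constant to every coordinate. -/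
theorem exists_sum_add_const_rpow_eq_one {ι : Type*} [Fintype ι] [Nonempty ι] {β : ℝ}
    (hβ : 0 ≤ β) {v : ι → ℝ} (hv : ∀ j, 0 ≤ v j) (hv1 : ∑ j, v j ^ β ≤ 1) :
    ∃ c : ℝ, 0 ≤ c ∧ ∑ j, (v j + c) ^ β = 1 := by
  have hcont : Continuous fun c : ℝ => ∑ j, (v j + c) ^ β :=
    continuous_finsetSum _ fun j _ =>
      (continuous_const.add continuous_id).rpow_const fun _ => Or.inr hβ
  have h1 : 1 ≤ ∑ j, (v j + 1) ^ β := by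
    have i : ι := Classical.arbitrary ι
    have hnonneg (j : ι) : 0 ≤ (v j + 1) ^ β := Real.rpow_nonneg (by linarith [hv j]) _
    exact (Real.one_le_rpow (by linarith [hv i]) hβ).trans
      (Finset.single_le_sum (f := fun j => (v j + 1) ^ β)
        (fun j _ => hnonneg j) (Finset.mem_univ i))
  obtain ⟨c, hc, hc1⟩ := intermediate_value_Icc zero_le_one hcont.continuousOn
    (show (1 : ℝ) ∈ Set.Icc (∑ j, (v j + 0) ^ β) (∑ j, (v j + 1) ^ β) from
      ⟨by simpa using hv1, h1⟩)
  exact ⟨c, hc.1, hc1⟩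

/-- the spherical scoring rule with parameter `α > 1`, whose expected
reward function is `G(p) = (Σ_j p_j^α)^{1/α}` and whose gradient has `j`-th component
`(Σ_k p_k^α)^{(1−α)/α} · p_j^{α−1}`, has convex exposure on `Δⁿ`: every convex
combination of two gradient values equals a gradient value plus `c·𝟙`. -/
theorem stmt_17 {n : ℕ} (hn : 2 ≤ n) (α : ℝ) (hα : 1 < α)
    (p q : Fin n → ℝ) (hp : p ∈ stdSimplex ℝ (Fin n)) (hq : q ∈ stdSimplex ℝ (Fin n))
    (w : ℝ) (hw : w ∈ Set.Icc (0:ℝ) 1) :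
    ∃ x ∈ stdSimplex ℝ (Fin n), ∃ c : ℝ, ∀ j : Fin n,
      (∑ k, x k ^ α) ^ ((1 - α) / α) * x j ^ (α - 1) =
        w * ((∑ k, p k ^ α) ^ ((1 - α) / α) * p j ^ (α - 1)) +
          (1 - w) * ((∑ k, q k ^ α) ^ ((1 - α) / α) * q j ^ (α - 1)) + c := by
  have : Nonempty (Fin n) := ⟨⟨0, by omega⟩⟩
  have hα1 : 0 < α - 1 := by linarith
  have hβ : 1 ≤ α / (α - 1) := by rw [le_div_iff₀ hα1]; linarith
  have hnonneg {r : Fin n → ℝ} (hr : r ∈ stdSimplex ℝ (Fin n)) (j : Fin n) :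
      0 ≤ (∑ k, r k ^ α) ^ ((1 - α) / α) * r j ^ (α - 1) :=
    mul_nonneg (Real.rpow_nonneg (Finset.sum_nonneg fun k _ => Real.rpow_nonneg (hr.1 k) _) _)
      (Real.rpow_nonneg (hr.1 j) _)
  have hw1 : 0 ≤ 1 - w := sub_nonneg.2 hw.2
  have hv (j : Fin n) := add_nonneg (mul_nonneg hw.1 (hnonneg hp j))
    (mul_nonneg hw1 (hnonneg hq j))
  have hball : ∑ j, (w * ((∑ k, p k ^ α) ^ ((1 - α) / α) * p j ^ (α - 1)) +
      (1 - w) * ((∑ k, q k ^ α) ^ ((1 - α) / α) * q j ^ (α - 1))) ^ (α / (α - 1)) ≤ 1 := by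
    refine (Finset.sum_le_sum fun j _ => (convexOn_rpow hβ).2 (hnonneg hp j) (hnonneg hq j)
      hw.1 hw1 (add_sub_cancel w 1)).trans_eq ?_
    simp only [smul_eq_mul]
    rw [Finset.sum_add_distrib, ← Finset.mul_sum, ← Finset.mul_sum,
      sum_spherical_gradient_rpow hα hp, sum_spherical_gradient_rpow hα hq]
    ring
  obtain ⟨c, hc, hc1⟩ := exists_sum_add_const_rpow_eq_one (zero_le_one.trans hβ) hv hball
  obtain ⟨x, hx, hxu⟩ := exists_spherical_gradient_eq hα (fun j => add_nonneg (hv j) hc) hc1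
  exact ⟨x, hx, c, hxu⟩
end

section
/- Let n ≥ 1 and let γ be real with 1 < γ ≤ 2. For every p, q ∈ Δⁿ and every w ∈ [0,1], there exist x ∈ Δⁿ and c ≥ 0 such that for every j ∈ {1,…,n}: x_j^{γ−1} = w·p_j^{γ−1} + (1−w)·q_j^{γ−1} + c. (That is, the Tsallis scoring rule with parameter γ ∈ (1,2], whose expected reward function is G(p) = Σ_j p_j^γ, has convex exposure on Δⁿ.) -/
open scoped BigOperators

/-- the Tsallis scoring rule with parameter `γ ∈ (1,2]`, whose expected
reward function is `G(p) = Σ_j p_j^γ` and whose gradient has `j`-th component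
`γ·p_j^{γ−1}`, has convex exposure on `Δⁿ`: every convex combination of two gradient
values equals a gradient value plus a constant `c ≥ 0` times `𝟙`. -/
theorem stmt_18 {n : ℕ} (hn : 1 ≤ n) (γ : ℝ) (hγ₁ : 1 < γ) (hγ₂ : γ ≤ 2)
    (p q : Fin n → ℝ) (hp : p ∈ stdSimplex ℝ (Fin n)) (hq : q ∈ stdSimplex ℝ (Fin n))
    (w : ℝ) (hw : w ∈ Set.Icc (0:ℝ) 1) :
    ∃ x ∈ stdSimplex ℝ (Fin n), ∃ c : ℝ, 0 ≤ c ∧ ∀ j : Fin n,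
      x j ^ (γ - 1) = w * p j ^ (γ - 1) + (1 - w) * q j ^ (γ - 1) + c := by
  obtain ⟨hw₀, hw₁⟩ := hw
  have hβ : 0 < γ - 1 := by linarith
  have ht : 1 ≤ (γ - 1)⁻¹ := (one_le_inv₀ hβ).2 (by linarith)
  have ht₀ : 0 ≤ (γ - 1)⁻¹ := zero_le_one.trans ht
  set a : Fin n → ℝ := fun j => w * p j ^ (γ - 1) + (1 - w) * q j ^ (γ - 1)
  have hp' : ∀ j, 0 ≤ p j ^ (γ - 1) := fun j => Real.rpow_nonneg (hp.1 j) _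
  have hq' : ∀ j, 0 ≤ q j ^ (γ - 1) := fun j => Real.rpow_nonneg (hq.1 j) _
  have ha₀ : ∀ j, 0 ≤ a j := fun j =>
    add_nonneg (mul_nonneg hw₀ (hp' j)) (mul_nonneg (sub_nonneg.2 hw₁) (hq' j))
  have hcont : ContinuousOn (fun c : ℝ => ∑ j, (a j + c) ^ (γ - 1)⁻¹) (Set.Icc 0 1) :=
    (continuous_finsetSum _ fun j _ =>
      (continuous_const.add continuous_id).rpow_const fun _ => Or.inr ht₀).continuousOn
  have hzero : ∑ j, (a j + 0) ^ (γ - 1)⁻¹ ≤ 1 := by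
    calc ∑ j, (a j + 0) ^ (γ - 1)⁻¹ ≤ ∑ j, (w * p j + (1 - w) * q j) := by
          refine Finset.sum_le_sum fun j _ => ?_
          have h := (convexOn_rpow ht).2 (hp' j) (hq' j) hw₀ (sub_nonneg.2 hw₁)
            (add_sub_cancel w 1)
          simpa only [smul_eq_mul, Real.rpow_rpow_inv (hp.1 j) hβ.ne',
            Real.rpow_rpow_inv (hq.1 j) hβ.ne', add_zero] using h
      _ = 1 := by
          rw [Finset.sum_add_distrib, ← Finset.mul_sum, ← Finset.mul_sum, hp.2, hq.2]
          ring
  have hone : 1 ≤ ∑ j, (a j + 1) ^ (γ - 1)⁻¹ := by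
    calc (1 : ℝ) ≤ n := by exact_mod_cast hn
      _ = ∑ _j : Fin n, (1 : ℝ) := by simp
      _ ≤ ∑ j, (a j + 1) ^ (γ - 1)⁻¹ := Finset.sum_le_sum fun j _ =>
          Real.one_le_rpow (by linarith [ha₀ j]) ht₀
  obtain ⟨c, hc, hsum⟩ := intermediate_value_Icc zero_le_one hcont ⟨hzero, hone⟩
  have hac : ∀ j, 0 ≤ a j + c := fun j => add_nonneg (ha₀ j) hc.1
  exact ⟨fun j => (a j + c) ^ (γ - 1)⁻¹, ⟨fun j => Real.rpow_nonneg (hac j) _, hsum⟩,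
    c, hc.1, fun j => Real.rpow_inv_rpow (hac j) hβ.ne'⟩
end

section
/- Let n ≥ 3 and let γ > 2 be real. Let p = e₁ and q = e₂ be the first two standard basis vectors of ℝⁿ (vertices of Δⁿ). Then there is no x ∈ Δⁿ and no c ∈ ℝ such that for every j ∈ {1,…,n}: x_j^{γ−1} = (1/2)·p_j^{γ−1} + (1/2)·q_j^{γ−1} + c. (That is, the Tsallis scoring rule with parameter γ > 2 does not have convex exposure on Δⁿ when n > 2.) -/
open scoped BigOperators

/-- for `n ≥ 3` and `γ > 2`, the Tsallis scoring rule with parameter `γ`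
does not have convex exposure on `Δⁿ`: taking `p = e₁`, `q = e₂` and weight `1/2`,
no `x ∈ Δⁿ` and `c ∈ ℝ` satisfy `x_j^{γ−1} = (1/2)·p_j^{γ−1} + (1/2)·q_j^{γ−1} + c`
for all `j`. -/
theorem stmt_19 {n : ℕ} (hn : 3 ≤ n) (γ : ℝ) (hγ : 2 < γ)
    (p q : Fin n → ℝ)
    (hp : p = Pi.single (⟨0, by omega⟩ : Fin n) 1)
    (hq : q = Pi.single (⟨1, by omega⟩ : Fin n) 1) :
    ¬ ∃ x ∈ stdSimplex ℝ (Fin n), ∃ c : ℝ, ∀ j : Fin n,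
        x j ^ (γ - 1) = (1 / 2) * p j ^ (γ - 1) + (1 / 2) * q j ^ (γ - 1) + c := by
  subst hp hq
  rintro ⟨x, ⟨hx0, hx1⟩, c, h⟩
  have hβ : 0 < γ - 1 := by linarith
  have hc : 0 ≤ c := by
    have h2 := h ⟨2, by omega⟩
    simp [Real.zero_rpow hβ.ne'] at h2
    exact h2 ▸ Real.rpow_nonneg (hx0 _) _
  have half_lt (j : Fin n) (hj : x j ^ (γ - 1) = 1 / 2 + c) : 1 / 2 < x j := by
    have hpow : (1 / 2 : ℝ) ^ (γ - 1) < 1 / 2 := by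
      simpa using Real.rpow_lt_rpow_of_exponent_gt (x := 1 / 2) (y := γ - 1) (z := 1)
        (by norm_num) (by norm_num) (by linarith)
    exact (Real.rpow_lt_rpow_iff (by norm_num) (hx0 j) hβ).1 (by linarith)
  have h0 := half_lt ⟨0, by omega⟩ (by
    rw [h]; simp [Real.zero_rpow hβ.ne'])
  have h1 := half_lt ⟨1, by omega⟩ (by
    rw [h]; simp [Real.zero_rpow hβ.ne'])
  have hle : x ⟨0, by omega⟩ + x ⟨1, by omega⟩ ≤ ∑ j, x j :=
    Finset.add_le_sum (fun j _ => hx0 j) (Finset.mem_univ _) (Finset.mem_univ _) (by simp)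
  linarith
end
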